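/- For any two integers n and n' with 5 ≤ n < n', the direct product Part(n) × Part(n') of the partition lattices Part(n) and Part(n') is a four-generated lattice. -/

import Mathlib

/-- A lattice is *four-generated* if it has a four-element subset `X` such that the
smallest sublattice containing `X` (the closure of `X` under binary meets and joins)
is the whole lattice. -/
def FourGenerated (L : Type*) [Lattice L] : Prop :=
  ∃ X : Finset L, X.card = 4 ∧ latticeClosure (X : Set L) = Set.univ

namespace PartitionLattice

instance finite_setoid {α : Type*} [Finite α] : Finite (Setoid α) :=
  Finite.of_injective (fun r : Setoid α => (r : α → α → Prop)) fun _ _ h =>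
    Setoid.ext fun x y => iff_of_eq (congrFun (congrFun h x) y)

/-- The equivalence relation whose only block with more than one element is (at most) `{x | p x}`. -/
def block {α : Type*} (p : α → Prop) : Setoid α where
  r x y := x = y ∨ p x ∧ p y
  iseqv := ⟨fun _ => Or.inl rfl, by rintro x y (h | h) <;> tauto,
    by rintro x y z (rfl | h) (rfl | h') <;> tauto⟩

lemma block_rel {α : Type*} {p : α → Prop} {x y : α} : block p x y ↔ x = y ∨ p x ∧ p y := Iff.rfl

/-- The equivalence relation identifying `i` and `j` and nothing else. -/
def atom {α : Type*} (i j : α) : Setoid α := block fun x => x = i ∨ x = j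

lemma atom_rel {α : Type*} {i j x y : α} :
    atom i j x y ↔ x = y ∨ (x = i ∨ x = j) ∧ (y = i ∨ y = j) := Iff.rfl

lemma atom_le_iff {α : Type*} {i j : α} {r : Setoid α} : atom i j ≤ r ↔ r i j := by
  constructor
  · intro h
    exact h (atom_rel.2 (by simp))
  · rintro h x y (rfl | ⟨rfl | rfl, rfl | rfl⟩)
    exacts [r.refl _, r.refl _, h, r.symm h, r.refl _]

lemma atom_comm {α : Type*} (i j : α) : atom i j = atom j i := by
  ext x y
  simp only [atom_rel]
  tauto

/-- The two classes of even and odd numbers. -/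
def parity (n : ℕ) : Setoid (Fin n) := Setoid.ker fun x => x.val % 2

/-- The partition of a path into disjoint edges, containing every edge `{i, i + 1}` for
`i` congruent to `b` modulo two. -/
def pairing (n b : ℕ) : Setoid (Fin n) := Setoid.ker fun x => (x.val + b) / 2

/-- The partition whose nontrivial blocks are `{0, 1}` and `{n - 3, n - 1}`. -/
def ends (n : ℕ) : Setoid (Fin n) :=
  Setoid.ker fun x => if x.val = 1 then 0 else if x.val = n - 1 then n - 3 else x.val

lemma parity_rel {n : ℕ} {x y : Fin n} : parity n x y ↔ x.val % 2 = y.val % 2 := Iff.rfl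

lemma pairing_rel {n b : ℕ} {x y : Fin n} :
    pairing n b x y ↔ (x.val + b) / 2 = (y.val + b) / 2 := Iff.rfl

lemma ends_rel {n : ℕ} {x y : Fin n} : ends n x y ↔
    (if x.val = 1 then 0 else if x.val = n - 1 then n - 3 else x.val) =
      (if y.val = 1 then 0 else if y.val = n - 1 then n - 3 else y.val) := Iff.rfl

lemma pairing_add_two (n b : ℕ) : pairing n (b + 2) = pairing n b := by
  ext x y
  simp only [pairing_rel]
  omega

lemma parity_inf_pairing_le (n b : ℕ) : parity n ⊓ pairing n b ≤ ⊥ := by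
  rintro x y ⟨h₁, h₂⟩
  change parity n x y at h₁
  change pairing n b x y at h₂
  rw [parity_rel] at h₁
  rw [pairing_rel] at h₂
  exact Fin.ext (by omega)

lemma pairing_sup_pairing (n : ℕ) : pairing n 0 ⊔ pairing n 1 = ⊤ := by
  have step : ∀ i (h : i + 1 < n),
      (pairing n 0 ⊔ pairing n 1) ⟨i, by omega⟩ ⟨i + 1, h⟩ := by
    intro i h
    rcases Nat.even_or_odd' i with ⟨k, rfl | rfl⟩
    · exact (le_sup_left : pairing n 0 ≤ _) (pairing_rel.2 (by simp; omega))
    · exact (le_sup_right : pairing n 1 ≤ _) (pairing_rel.2 (by simp; omega))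
  have zero : ∀ i (h : i < n), (pairing n 0 ⊔ pairing n 1) ⟨0, by omega⟩ ⟨i, h⟩ := by
    intro i
    induction i with
    | zero => exact fun _ => Setoid.refl' _ _
    | succ i ih => exact fun h => Setoid.trans' _ (ih (by omega)) (step i h)
  refine eq_top_iff.2 fun x y _ => ?_
  exact Setoid.trans' _ (Setoid.symm' _ (zero x x.2)) (zero y y.2)

section Cross

variable {n m : ℕ} {s : Fin n → Fin n → Setoid (Fin m)}

/-- A join-compatible assignment exchanging the roles of the two pairings is trivial. -/
lemma eq_bot_of_swap (hn : 5 ≤ n) (hm : 5 ≤ m) (symm : ∀ i j, s i j = s j i)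
    (tri : ∀ i j k, s i k ≤ s i j ⊔ s j k)
    (hpar : ∀ i j, parity n i j → s i j ≤ parity m)
    (hpair : ∀ b i j, pairing n b i j → s i j ≤ pairing m (b + 1))
    (hends : ∀ i j, ends n i j → s i j ≤ ends m) (i j : Fin n) : s i j = ⊥ := by
  have edge : ∀ i (h : i + 1 < n), s ⟨i, by omega⟩ ⟨i + 1, h⟩ = ⊥ := by
    intro i
    induction i with
    | zero =>
      intro h
      refine eq_bot_iff.2 fun x y hxy => ?_
      have h₁ := pairing_rel.1 (hpair 0 _ _ (pairing_rel.2 (by simp)) hxy)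
      have h₂ := ends_rel.1 (hends _ _ (ends_rel.2 (by simp; omega)) hxy)
      refine Fin.ext ?_
      split_ifs at h₂ <;> omega
    | succ i ih =>
      intro h
      have ih := ih (by omega)
      have h₁ := tri ⟨i + 1, by omega⟩ ⟨i, by omega⟩ ⟨i + 1 + 1, h⟩
      rw [symm ⟨i + 1, _⟩ ⟨i, _⟩, ih, bot_sup_eq] at h₁
      have h₂ := hpar ⟨i, by omega⟩ ⟨i + 1 + 1, h⟩ (parity_rel.2 (by simp; omega))
      have h₃ := hpair (i + 1) ⟨i + 1, by omega⟩ ⟨i + 1 + 1, h⟩ (pairing_rel.2 (by simp; omega))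
      exact eq_bot_iff.2 ((le_inf (h₁.trans h₂) h₃).trans (parity_inf_pairing_le _ _))
  have refl : ∀ i, s i i = ⊥ := by
    intro i
    exact eq_bot_iff.2 ((le_inf (hpar i i rfl) (hpair 0 i i rfl)).trans (parity_inf_pairing_le _ _))
  have zero : ∀ i (h : i < n), s ⟨0, by omega⟩ ⟨i, h⟩ = ⊥ := by
    intro i
    induction i with
    | zero => exact fun h => refl _
    | succ i ih =>
      intro h
      have h₁ := tri ⟨0, by omega⟩ ⟨i, by omega⟩ ⟨i + 1, h⟩
      rwa [ih (by omega), edge i h, sup_bot_eq, le_bot_iff] at h₁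
  have h₁ := tri i ⟨0, by omega⟩ j
  rwa [symm i ⟨0, _⟩, zero i i.2, zero j j.2, sup_bot_eq, le_bot_iff] at h₁

end Cross

section Rigid

variable {n : ℕ} {s : Fin n → Fin n → Setoid (Fin n)}

lemma edge_le_initial (hn : 5 ≤ n) (symm : ∀ i j, s i j = s j i)
    (tri : ∀ i j k, s i k ≤ s i j ⊔ s j k)
    (hpar : ∀ i j, parity n i j → s i j ≤ parity n)
    (hpair : ∀ b i j, pairing n b i j → s i j ≤ pairing n b)
    (hends : ∀ i j, ends n i j → s i j ≤ ends n) (i : ℕ) (h : i + 1 < n) :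
    s ⟨i, by omega⟩ ⟨i + 1, h⟩ ≤ block fun x => x.val ≤ i + 1 := by
  induction i with
  | zero =>
    intro x y hxy
    have h₁ := pairing_rel.1 (hpair 0 _ _ (pairing_rel.2 (by simp)) hxy)
    have h₂ := ends_rel.1 (hends _ _ (ends_rel.2 (by simp; omega)) hxy)
    refine block_rel.2 ?_
    rw [Fin.ext_iff]
    split_ifs at h₂ <;> omega
  | succ i ih =>
    have ih := ih (by omega)
    have hskip : s ⟨i, by omega⟩ ⟨i + 1 + 1, h⟩ ≤ block fun x => x.val ≤ i + 1 + 1 := by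
      have hle : s ⟨i, by omega⟩ ⟨i + 1 + 1, h⟩ ≤
          Setoid.ker fun x : Fin n =>
            if x.val ≤ i + 1 + 1 then 0 else (x.val + (i + 1)) / 2 + 1 := by
        refine (tri _ ⟨i + 1, by omega⟩ _).trans (sup_le (ih.trans ?_)
          ((hpair (i + 1) _ _ (pairing_rel.2 (by simp; omega))).trans ?_))
        · rintro x y (rfl | ⟨hx, hy⟩)
          · rfl
          · rw [Setoid.ker_def, if_pos (by omega), if_pos (by omega)]
        · intro x y hxy
          have hxy := pairing_rel.1 hxy
          rw [Setoid.ker_def]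
          split_ifs <;> omega
      intro x y hxy
      have h₁ := parity_rel.1 (hpar _ _ (parity_rel.2 (by simp; omega)) hxy)
      have h₂ := hle hxy
      rw [Setoid.ker_def] at h₂
      refine block_rel.2 ?_
      rw [Fin.ext_iff]
      split_ifs at h₂ <;> omega
    refine (tri _ ⟨i, by omega⟩ _).trans (sup_le ?_ hskip)
    rw [symm]
    exact ih.trans fun x y => Or.imp_right fun h => by omega

lemma edge_le_final (hn : 5 ≤ n) (symm : ∀ i j, s i j = s j i)
    (tri : ∀ i j k, s i k ≤ s i j ⊔ s j k)
    (hpar : ∀ i j, parity n i j → s i j ≤ parity n)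
    (hpair : ∀ b i j, pairing n b i j → s i j ≤ pairing n b)
    (hends : ∀ i j, ends n i j → s i j ≤ ends n) (i k : ℕ) (hk : i + k + 2 = n) :
    s ⟨i, by omega⟩ ⟨i + 1, by omega⟩ ≤ block fun x => i ≤ x.val := by
  induction k generalizing i with
  | zero =>
    obtain ⟨i, rfl⟩ : ∃ l, i = l + 1 := ⟨i - 1, by omega⟩
    have hle : s ⟨i + 1, by omega⟩ ⟨i + 1 + 1, by omega⟩ ≤
        Setoid.ker fun x : Fin n => if i ≤ x.val then n else (x.val + i) / 2 := by
      refine (tri _ ⟨i, by omega⟩ _).trans (sup_le ?_ ?_)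
      · rw [symm]
        refine (hpair i _ _ (pairing_rel.2 (by simp; omega))).trans ?_
        intro x y hxy
        have hxy := pairing_rel.1 hxy
        rw [Setoid.ker_def]
        split_ifs <;> omega
      · intro x y hxy
        have h₁ := parity_rel.1 (hpar _ _ (parity_rel.2 (by simp; omega)) hxy)
        have h₂ := ends_rel.1 (hends _ _ (ends_rel.2 (by
          simp only
          split_ifs <;> omega)) hxy)
        rw [Setoid.ker_def]
        split_ifs at h₂ ⊢ <;> omega
    intro x y hxy
    have h₁ := pairing_rel.1 (hpair (i + 1) _ _ (pairing_rel.2 (by simp; omega)) hxy)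
    have h₂ := hle hxy
    rw [Setoid.ker_def] at h₂
    refine block_rel.2 ?_
    rw [Fin.ext_iff]
    split_ifs at h₂ <;> omega
  | succ k ih =>
    have ih := ih (i + 1) (by omega)
    have hskip : s ⟨i, by omega⟩ ⟨i + 1 + 1, by omega⟩ ≤ block fun x => i ≤ x.val := by
      have hle : s ⟨i, by omega⟩ ⟨i + 1 + 1, by omega⟩ ≤
          Setoid.ker fun x : Fin n => if i ≤ x.val then n else (x.val + i) / 2 := by
        refine (tri _ ⟨i + 1, by omega⟩ _).trans (sup_le
          ((hpair i _ _ (pairing_rel.2 (by simp; omega))).trans ?_) (ih.trans ?_))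
        · intro x y hxy
          have hxy := pairing_rel.1 hxy
          rw [Setoid.ker_def]
          split_ifs <;> omega
        · rintro x y (rfl | ⟨hx, hy⟩)
          · rfl
          · rw [Setoid.ker_def, if_pos (by omega), if_pos (by omega)]
      intro x y hxy
      have h₁ := parity_rel.1 (hpar _ _ (parity_rel.2 (by simp; omega)) hxy)
      have h₂ := hle hxy
      rw [Setoid.ker_def] at h₂
      refine block_rel.2 ?_
      rw [Fin.ext_iff]
      split_ifs at h₂ <;> omega
    refine (tri _ ⟨i + 1 + 1, by omega⟩ _).trans (sup_le hskip ?_)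
    rw [symm]
    exact ih.trans fun x y => Or.imp_right fun h => by omega

lemma le_atom (hn : 5 ≤ n) (symm : ∀ i j, s i j = s j i)
    (tri : ∀ i j k, s i k ≤ s i j ⊔ s j k)
    (hpar : ∀ i j, parity n i j → s i j ≤ parity n)
    (hpair : ∀ b i j, pairing n b i j → s i j ≤ pairing n b)
    (hends : ∀ i j, ends n i j → s i j ≤ ends n) (i j : Fin n) : s i j ≤ atom i j := by
  have edge : ∀ i (h : i + 1 < n),
      s ⟨i, by omega⟩ ⟨i + 1, h⟩ ≤ atom ⟨i, by omega⟩ ⟨i + 1, h⟩ := by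
    intro i h x y hxy
    have h₁ := block_rel.1 (edge_le_initial hn symm tri hpar hpair hends i h hxy)
    have h₂ := block_rel.1 (edge_le_final hn symm tri hpar hpair hends i (n - (i + 2))
      (by omega) hxy)
    rw [atom_rel]
    simp only [Fin.ext_iff] at *
    omega
  have skip : ∀ i (h : i + 2 < n),
      s ⟨i, by omega⟩ ⟨i + 2, h⟩ ≤ atom ⟨i, by omega⟩ ⟨i + 2, h⟩ := by
    intro i h
    have hle : s ⟨i, by omega⟩ ⟨i + 2, h⟩ ≤
        block fun x => x.val = i ∨ x.val = i + 1 ∨ x.val = i + 2 := by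
      refine (tri _ ⟨i + 1, by omega⟩ _).trans (sup_le ((edge i (by omega)).trans ?_)
        ((edge (i + 1) h).trans ?_)) <;>
      · rw [atom_le_iff, block_rel]
        simp
    intro x y hxy
    have h₁ := block_rel.1 (hle hxy)
    have h₂ := parity_rel.1 (hpar _ _ (parity_rel.2 (by simp)) hxy)
    rw [atom_rel]
    simp only [Fin.ext_iff] at *
    omega
  have main : ∀ k i (h : i + k < n),
      s ⟨i, by omega⟩ ⟨i + k, h⟩ ≤ atom ⟨i, by omega⟩ ⟨i + k, h⟩ := by
    intro k
    induction k using Nat.strong_induction_on with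
    | _ k ih =>
    intro i h
    match k, ih, h with
    | 0, _, h =>
      exact ((le_inf (hpar _ _ rfl) (hpair 0 _ _ rfl)).trans
        (parity_inf_pairing_le _ _)).trans bot_le
    | 1, _, h => exact edge i h
    | 2, _, h => exact skip i h
    | k + 3, ih, h =>
      have h₁ : s ⟨i, by omega⟩ ⟨i + (k + 3), h⟩ ≤
          block fun x => x.val = i ∨ x.val = i + 1 ∨ x.val = i + (k + 3) := by
        have := ih (k + 2) (by omega) (i + 1) (by omega)
        simp only [show i + 1 + (k + 2) = i + (k + 3) by omega] at this
        refine (tri _ ⟨i + 1, by omega⟩ _).trans (sup_le ((edge i (by omega)).trans ?_)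
          (this.trans ?_)) <;>
        · rw [atom_le_iff, block_rel]
          simp
      have h₂ : s ⟨i, by omega⟩ ⟨i + (k + 3), h⟩ ≤
          block fun x => x.val = i ∨ x.val = i + 2 ∨ x.val = i + (k + 3) := by
        have := ih (k + 1) (by omega) (i + 2) (by omega)
        simp only [show i + 2 + (k + 1) = i + (k + 3) by omega] at this
        refine (tri _ ⟨i + 2, by omega⟩ _).trans (sup_le ((skip i (by omega)).trans ?_)
          (this.trans ?_)) <;>
        · rw [atom_le_iff, block_rel]
          simp
      intro x y hxy
      have h₁ := block_rel.1 (h₁ hxy)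
      have h₂ := block_rel.1 (h₂ hxy)
      rw [atom_rel]
      simp only [Fin.ext_iff] at *
      omega
  rcases le_total i j with h | h
  · have := main (j - i) i (by omega)
    simpa only [Nat.add_sub_cancel' (show i.val ≤ j.val from h)] using this
  · have := main (i - j) j (by omega)
    rw [symm, atom_comm]
    simpa only [Nat.add_sub_cancel' (show j.val ≤ i.val from h)] using this

end Rigid

section Generation

variable {n m : ℕ}

/-- A sublattice of a product of two partition lattices that contains the four pairs built from
`parity`, the two `pairing`s (exchanged in the second factor) and `ends` contains every atom of the
first factor. -/
lemma atom_bot_mem (hn : 5 ≤ n) (hm : 5 ≤ m) {S : Set (Setoid (Fin n) × Setoid (Fin m))}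
    (hS : IsSublattice S) (hpar : (parity n, parity m) ∈ S)
    (hpair₀ : (pairing n 0, pairing m 1) ∈ S) (hpair₁ : (pairing n 1, pairing m 0) ∈ S)
    (hends : (ends n, ends m) ∈ S) (i j : Fin n) : (atom i j, (⊥ : Setoid (Fin m))) ∈ S := by
  have htop : (⊤ : Setoid (Fin n) × Setoid (Fin m)) ∈ S := by
    have h := hS.supClosed hpair₀ hpair₁
    rwa [Prod.mk_sup_mk, pairing_sup_pairing, sup_comm, pairing_sup_pairing] at h
  have hpair : ∀ b, (pairing n b, pairing m (b + 1)) ∈ S := by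
    intro b
    induction b using Nat.twoStepInduction with
    | zero => exact hpair₀
    | one => rwa [pairing_add_two m 0]
    | more b ih _ => rwa [pairing_add_two, show b + 2 + 1 = b + 1 + 2 by rfl, pairing_add_two]
  set c : Fin n → Fin n → Setoid (Fin n) × Setoid (Fin m) :=
    fun i j => sInf {a ∈ S | a.1 i j} with hc
  have mem : ∀ i j, c i j ∈ S := fun i j =>
    hS.infClosed.sInf_mem (Set.toFinite _) htop fun _ h => h.1
  have rel : ∀ i j, (c i j).1 i j := by
    intro i j
    rw [← atom_le_iff]
    have h : (atom i j, (⊥ : Setoid (Fin m))) ≤ c i j :=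
      le_sInf fun a ha => ⟨atom_le_iff.2 ha.2, bot_le⟩
    exact h.1
  have le : ∀ i j a, a ∈ S → a.1 i j → c i j ≤ a := fun i j a ha h => sInf_le ⟨ha, h⟩
  have symm : ∀ i j, c i j = c j i := fun i j =>
    le_antisymm (le _ _ _ (mem j i) (Setoid.symm' _ (rel j i)))
      (le _ _ _ (mem i j) (Setoid.symm' _ (rel i j)))
  have tri : ∀ i j k, c i k ≤ c i j ⊔ c j k := by
    refine fun i j k => le _ _ _ (hS.supClosed (mem i j) (mem j k)) ?_
    exact Setoid.trans' _ ((le_sup_left : (c i j).1 ≤ _) (rel i j))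
      ((le_sup_right : (c j k).1 ≤ _) (rel j k))
  have h₁ : (c i j).1 ≤ atom i j :=
    le_atom (s := fun i j => (c i j).1) hn (fun i j => congrArg Prod.fst (symm i j))
      (fun i j k => (tri i j k).1) (fun i j h => (le i j _ hpar h).1)
      (fun b i j h => (le i j _ (hpair b) h).1) (fun i j h => (le i j _ hends h).1) i j
  have h₂ : (c i j).2 = ⊥ :=
    eq_bot_of_swap (s := fun i j => (c i j).2) hn hm (fun i j => congrArg Prod.snd (symm i j))
      (fun i j k => (tri i j k).2) (fun i j h => (le i j _ hpar h).2)
      (fun b i j h => (le i j _ (hpair b) h).2) (fun i j h => (le i j _ hends h).2) i j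
  have h : c i j = (atom i j, ⊥) :=
    Prod.ext (le_antisymm h₁ (atom_le_iff.2 (rel i j))) h₂
  exact h ▸ mem i j

lemma eq_univ_of_isSublattice (hn : 5 ≤ n) (hm : 5 ≤ m)
    {S : Set (Setoid (Fin n) × Setoid (Fin m))}
    (hS : IsSublattice S) (hpar : (parity n, parity m) ∈ S)
    (hpair₀ : (pairing n 0, pairing m 1) ∈ S) (hpair₁ : (pairing n 1, pairing m 0) ∈ S)
    (hends : (ends n, ends m) ∈ S) : S = Set.univ := by
  have hfst := atom_bot_mem hn hm hS hpar hpair₀ hpair₁ hends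
  have hsnd : ∀ i j : Fin m, ((⊥ : Setoid (Fin n)), atom i j) ∈ S := by
    refine atom_bot_mem (S := Prod.swap ⁻¹' S) hm hn ⟨?_, ?_⟩ hpar hpair₁ hpair₀ hends
    · exact fun a ha b hb => hS.supClosed ha hb
    · exact fun a ha b hb => hS.infClosed ha hb
  have hbot : (⊥ : Setoid (Fin n) × Setoid (Fin m)) ∈ S := by
    have h := hS.infClosed (hfst ⟨0, by omega⟩ ⟨0, by omega⟩) (hsnd ⟨0, by omega⟩ ⟨0, by omega⟩)
    rwa [Prod.mk_inf_mk, inf_bot_eq, bot_inf_eq] at h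
  refine Set.eq_univ_of_forall fun u => ?_
  have hmem : sSup {a ∈ S | a ≤ u} ∈ S :=
    hS.supClosed.sSup_mem (Set.toFinite _) hbot fun _ h => h.1
  suffices h : u = sSup {a ∈ S | a ≤ u} from h ▸ hmem
  refine le_antisymm (Prod.le_def.2 ⟨fun i j h => ?_, fun i j h => ?_⟩)
    (sSup_le fun a ha => ha.2)
  · have hle : (atom i j, ⊥) ≤ sSup {a ∈ S | a ≤ u} :=
      le_sSup ⟨hfst i j, atom_le_iff.2 h, bot_le⟩
    exact atom_le_iff.1 hle.1
  · have hle : (⊥, atom i j) ≤ sSup {a ∈ S | a ≤ u} :=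
      le_sSup ⟨hsnd i j, bot_le, atom_le_iff.2 h⟩
    exact atom_le_iff.1 hle.2

end Generation

end PartitionLattice

open PartitionLattice

theorem part_prod_fourGenerated (n n' : ℕ) (hn : 5 ≤ n) (hnn' : n < n') :
    FourGenerated (Setoid (Fin n) × Setoid (Fin n')) := by
  classical
  have p₀₁ : pairing n 0 ⟨0, by omega⟩ ⟨1, by omega⟩ := pairing_rel.2 (by simp)
  have p₂₃ : pairing n 0 ⟨2, by omega⟩ ⟨3, by omega⟩ := pairing_rel.2 (by simp)
  have q₁₂ : pairing n 1 ⟨1, by omega⟩ ⟨2, by omega⟩ := pairing_rel.2 (by simp)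
  have e₀₁ : ends n ⟨0, by omega⟩ ⟨1, by omega⟩ := ends_rel.2 (by simp; omega)
  have hparity : ¬ parity n ⟨0, by omega⟩ ⟨1, by omega⟩ := by simp [parity_rel]
  have hparity' : ¬ parity n ⟨1, by omega⟩ ⟨2, by omega⟩ := by simp [parity_rel]
  have hpairing : ¬ pairing n 1 ⟨0, by omega⟩ ⟨1, by omega⟩ := by simp [pairing_rel]
  have hends : ¬ ends n ⟨2, by omega⟩ ⟨3, by omega⟩ := by
    rw [ends_rel]
    split_ifs <;> simp_all <;> omega
  refine ⟨{(parity n, parity n'), (pairing n 0, pairing n' 1), (pairing n 1, pairing n' 0),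
    (ends n, ends n')}, ?_, ?_⟩
  · have h₁ : parity n ≠ pairing n 0 := fun h => hparity (h ▸ p₀₁)
    have h₂ : parity n ≠ pairing n 1 := fun h => hparity' (h ▸ q₁₂)
    have h₃ : parity n ≠ ends n := fun h => hparity (h ▸ e₀₁)
    have h₄ : pairing n 0 ≠ pairing n 1 := fun h => hpairing (h ▸ p₀₁)
    have h₅ : pairing n 0 ≠ ends n := fun h => hends (h ▸ p₂₃)
    have h₆ : pairing n 1 ≠ ends n := fun h => hpairing (h ▸ e₀₁)
    simp [Finset.card_insert_of_notMem, h₁, h₂, h₃, h₄, h₅, h₆]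
  · apply eq_univ_of_isSublattice hn (by omega) isSublattice_latticeClosure <;>
    · apply subset_latticeClosure
      simp
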